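/- The ring of invariants of SL(2,ℂ) acting on Sym^4(ℂ^2) (binary quartic forms) is a polynomial ring on two generators g₂, g₃ of degrees 2 and 3 in the coefficients, and consequently Proj of this invariant ring is isomorphic to ℙ^1. -/

import Mathlib

open MvPolynomial Matrix AlgebraicGeometry CategoryTheory

/-- The binary quartic form with coefficient vector `a`:
`∑ᵢ aᵢ x^i y^(4-i)`. -/
noncomputable def quarticForm (a : Fin 5 → ℂ) : MvPolynomial (Fin 2) ℂ :=
  ∑ i : Fin 5, C (a i) * X 0 ^ (i : ℕ) * X 1 ^ (4 - (i : ℕ))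

/-- The action of `SL(2,ℂ)` on binary forms by linear substitution of the variables. -/
noncomputable def sl2Subst (g : SpecialLinearGroup (Fin 2) ℂ)
    (p : MvPolynomial (Fin 2) ℂ) : MvPolynomial (Fin 2) ℂ :=
  aeval (fun j : Fin 2 => ∑ k : Fin 2, C (g.1 k j) * X k) p

/-- The coefficient vector of the transform of the quartic with coefficients `a`
under `g ∈ SL(2,ℂ)`. -/
noncomputable def transformedCoeff (g : SpecialLinearGroup (Fin 2) ℂ)
    (a : Fin 5 → ℂ) (i : Fin 5) : ℂ :=
  MvPolynomial.coeff
    (Finsupp.single (0 : Fin 2) (i : ℕ) + Finsupp.single (1 : Fin 2) (4 - (i : ℕ)))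
    (sl2Subst g (quarticForm a))

/-- A polynomial function on the 5-dimensional space `Sym⁴(ℂ²)` of binary quartics is
an `SL(2,ℂ)`-invariant if it takes the same value on a quartic and on any of its
`SL(2,ℂ)`-transforms. -/
def IsQuarticInvariant (P : MvPolynomial (Fin 5) ℂ) : Prop :=
  ∀ (g : SpecialLinearGroup (Fin 2) ℂ) (a : Fin 5 → ℂ),
    eval (transformedCoeff g a) P = eval a P

/-- The grading of `ℂ[u,v]` in which the variables have the given weights. -/
noncomputable instance gradingW (w : Fin 2 → ℕ) :
    GradedAlgebra (weightedHomogeneousSubmodule ℂ w) :=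
  weightedGradedAlgebra ℂ w


section Invariants

/-- The coefficients of the transformed quartic, explicitly, where
`x ↦ p x + q y`, `y ↦ r x + s y`. -/
def tc (p q r s : ℂ) (a : Fin 5 → ℂ) : Fin 5 → ℂ :=
  ![a 4 * q^4 + a 3 * q^3 * s + a 2 * q^2 * s^2 + a 1 * q * s^3 + a 0 * s^4,
    a 4 * (4 * p * q^3) + a 3 * (3 * p * q^2 * s + q^3 * r) + a 2 * (2 * p * q * s^2 + 2 * q^2 * r * s)
      + a 1 * (p * s^3 + 3 * q * r * s^2) + a 0 * (4 * r * s^3),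
    a 4 * (6 * p^2 * q^2) + a 3 * (3 * p^2 * q * s + 3 * p * q^2 * r)
      + a 2 * (p^2 * s^2 + 4 * p * q * r * s + q^2 * r^2)
      + a 1 * (3 * p * r * s^2 + 3 * q * r^2 * s) + a 0 * (6 * r^2 * s^2),
    a 4 * (4 * p^3 * q) + a 3 * (p^3 * s + 3 * p^2 * q * r) + a 2 * (2 * p^2 * r * s + 2 * p * q * r^2)
      + a 1 * (3 * p * r^2 * s + q * r^3) + a 0 * (4 * r^3 * s),
    a 4 * p^4 + a 3 * p^3 * r + a 2 * p^2 * r^2 + a 1 * p * r^3 + a 0 * r^4]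

lemma subst_quarticForm (g : SpecialLinearGroup (Fin 2) ℂ) (a : Fin 5 → ℂ) :
    sl2Subst g (quarticForm a) =
      quarticForm (tc (g.1 0 0) (g.1 1 0) (g.1 0 1) (g.1 1 1) a) := by
  simp only [sl2Subst, quarticForm, Fin.sum_univ_five, Fin.sum_univ_two, map_add, map_mul, map_pow,
    aeval_X, tc, algHom_C, algebraMap_eq]
  simp only [Fin.isValue, Fin.coe_ofNat_eq_mod, Matrix.cons_val, map_add, map_mul, map_pow,
    map_ofNat]
  norm_num
  ring

lemma coeff_quarticForm (a : Fin 5 → ℂ) (i : Fin 5) :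
    MvPolynomial.coeff
      (Finsupp.single (0 : Fin 2) (i : ℕ) + Finsupp.single (1 : Fin 2) (4 - (i : ℕ)))
      (quarticForm a) = a i := by
  classical
  have h : ∀ j : Fin 5, C (a j) * X 0 ^ (j : ℕ) * X 1 ^ (4 - (j : ℕ)) =
      monomial (Finsupp.single (0 : Fin 2) (j : ℕ) + Finsupp.single (1 : Fin 2) (4 - (j : ℕ)))
        (a j) := by
    intro j
    rw [X_pow_eq_monomial, X_pow_eq_monomial, C_mul_monomial, monomial_mul]
    simp
  simp only [quarticForm, h, coeff_sum, coeff_monomial]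
  rw [Finset.sum_eq_single i]
  · simp
  · intro j _ hj
    rw [if_neg]
    intro e
    apply hj
    have := congrArg (fun r => r 0) e
    simp at this
    exact Fin.ext this
  · simp

lemma transformedCoeff_eq (g : SpecialLinearGroup (Fin 2) ℂ) (a : Fin 5 → ℂ) :
    transformedCoeff g a = tc (g.1 0 0) (g.1 1 0) (g.1 0 1) (g.1 1 1) a := by
  ext i
  rw [transformedCoeff, subst_quarticForm, coeff_quarticForm]

lemma isQuarticInvariant_iff (P : MvPolynomial (Fin 5) ℂ) :
    IsQuarticInvariant P ↔ ∀ (p q r s : ℂ) (a : Fin 5 → ℂ), p * s - q * r = 1 →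
      eval (tc p q r s a) P = eval a P := by
  constructor
  · intro h p q r s a hd
    let g : SpecialLinearGroup (Fin 2) ℂ :=
      ⟨!![p, r; q, s], by rw [Matrix.det_fin_two]; simp; linear_combination hd⟩
    have := h g a
    rw [transformedCoeff_eq g a] at this
    simpa [g] using this
  · intro h g a
    rw [transformedCoeff_eq]
    apply h
    have := g.2
    rw [Matrix.det_fin_two] at this
    linear_combination this

/-- The invariant of degree two. -/
noncomputable def invI : MvPolynomial (Fin 5) ℂ :=
  12 * X 4 * X 0 - 3 * X 3 * X 1 + X 2 ^ 2

/-- The invariant of degree three. -/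
noncomputable def invJ : MvPolynomial (Fin 5) ℂ :=
  72 * X 4 * X 2 * X 0 + 9 * X 3 * X 2 * X 1 - 27 * X 4 * X 1 ^ 2 - 27 * X 0 * X 3 ^ 2
    - 2 * X 2 ^ 3

lemma invI_inv : IsQuarticInvariant invI := by
  rw [isQuarticInvariant_iff]
  intro p q r s a hd
  have key : eval (tc p q r s a) invI = (p * s - q * r) ^ 4 * eval a invI := by
    simp [invI, tc]
    ring
  rw [key, hd, one_pow, one_mul]

lemma invJ_inv : IsQuarticInvariant invJ := by
  rw [isQuarticInvariant_iff]
  intro p q r s a hd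
  have key : eval (tc p q r s a) invJ = (p * s - q * r) ^ 6 * eval a invJ := by
    simp [invJ, tc]
    ring
  rw [key, hd, one_pow, one_mul]

lemma homog_X (i : Fin 5) : (X i : MvPolynomial (Fin 5) ℂ).IsHomogeneous 1 := isHomogeneous_X ℂ i

lemma invI_homog : invI.IsHomogeneous 2 := by
  have e : invI = C 12 * (X 4 * X 0) - C 3 * (X 3 * X 1) + X 2 ^ 2 := by
    simp only [invI, map_ofNat]; ring
  rw [e]
  refine ((IsHomogeneous.C_mul ((homog_X 4).mul (homog_X 0)) _).sub
    (IsHomogeneous.C_mul ((homog_X 3).mul (homog_X 1)) _)).add ?_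
  exact (homog_X 2).pow 2

lemma invJ_homog : invJ.IsHomogeneous 3 := by
  have e : invJ = C 72 * (X 4 * X 2 * X 0) + C 9 * (X 3 * X 2 * X 1) - C 27 * (X 4 * X 1 * X 1)
      - C 27 * (X 0 * X 3 * X 3) - C 2 * (X 2 ^ 3) := by
    simp only [invJ, map_ofNat]; ring
  rw [e]
  have h : ∀ i j k : Fin 5, (X i * X j * X k : MvPolynomial (Fin 5) ℂ).IsHomogeneous 3 :=
    fun i j k => ((homog_X i).mul (homog_X j)).mul (homog_X k)
  exact ((((h _ _ _).C_mul _).add ((h _ _ _).C_mul _)).sub ((h _ _ _).C_mul _)).sub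
    ((h _ _ _).C_mul _) |>.sub (((homog_X 2).pow 3).C_mul _)

/-- The section of Weierstrass quartics `x³y + p x y³ + q y⁴`. -/
noncomputable def slice (v : Fin 2 → ℂ) : Fin 5 → ℂ := ![-27⁻¹ * v 1, -3⁻¹ * v 0, 0, 1, 0]

lemma eval_slice (v : Fin 2 → ℂ) (F : MvPolynomial (Fin 2) ℂ) :
    eval (slice v) (aeval (R := ℂ) ![invI, invJ] F) = eval v F := by
  have h : (![invI, invJ] : Fin 2 → MvPolynomial (Fin 5) ℂ) = fun i => ![invI, invJ] i := rfl
  have : (eval (slice v)).comp (aeval (R := ℂ) ![invI, invJ] : _ →ₐ[ℂ] _).toRingHom = eval v := by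
    apply MvPolynomial.ringHom_ext
    · intro c
      simp
    · intro i
      fin_cases i
      · simp [invI, slice]
      · simp [invJ, slice]
  exact congrArg (fun r => r F) this

/-- Restriction of a polynomial to the section. -/
noncomputable def restr (P : MvPolynomial (Fin 5) ℂ) : MvPolynomial (Fin 2) ℂ :=
  aeval (R := ℂ) ![C (-27⁻¹) * X 1, C (-3⁻¹) * X 0, 0, 1, 0] P

lemma eval_restr (v : Fin 2 → ℂ) (P : MvPolynomial (Fin 5) ℂ) :
    eval v (restr P) = eval (slice v) P := by
  have : (eval v).comp (aeval (R := ℂ) (![C (-27⁻¹) * X 1, C (-3⁻¹) * X 0, 0, 1, 0] :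
      Fin 5 → MvPolynomial (Fin 2) ℂ) : _ →ₐ[ℂ] _).toRingHom = eval (slice v) := by
    apply MvPolynomial.ringHom_ext
    · intro c
      simp
    · intro i
      fin_cases i <;> simp [slice]
  exact congrArg (fun r => r P) this

lemma aeval_inj : Function.Injective (aeval (R := ℂ) ![invI, invJ]) := by
  intro F G h
  apply MvPolynomial.funext
  intro v
  rw [← eval_slice, h, eval_slice]

lemma aeval_inv (F : MvPolynomial (Fin 2) ℂ) :
    IsQuarticInvariant (aeval (R := ℂ) ![invI, invJ] F) := by
  intro g a
  have : (eval (transformedCoeff g a)).comp (aeval (R := ℂ) ![invI, invJ] : _ →ₐ[ℂ] _).toRingHom =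
      (eval a).comp (aeval (R := ℂ) ![invI, invJ] : _ →ₐ[ℂ] _).toRingHom := by
    apply MvPolynomial.ringHom_ext
    · intro c
      simp
    · intro i
      fin_cases i
      · simpa using invI_inv g a
      · simpa using invJ_inv g a
  exact congrArg (fun r => r F) this

/-- An invariant vanishing on the section vanishes on quartics with `a₄ = 0`, `a₃ ≠ 0`. -/
lemma vanish1 (Q : MvPolynomial (Fin 5) ℂ) (hQ : IsQuarticInvariant Q)
    (h0 : ∀ v, eval (slice v) Q = 0) (a : Fin 5 → ℂ) (h4 : a 4 = 0) (h3 : a 3 ≠ 0) :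
    eval a Q = 0 := by
  obtain ⟨t, ht⟩ := IsAlgClosed.exists_pow_nat_eq (a 3)⁻¹ (n := 2) (by norm_num)
  have ht0 : t ≠ 0 := by
    rintro rfl
    simp at ht
    exact h3 ht.symm
  have ht' : t ^ 2 * a 3 = 1 := by rw [ht, inv_mul_cancel₀ h3]
  have hs : t⁻¹ * t = 1 := inv_mul_cancel₀ ht0
  rw [isQuarticInvariant_iff] at hQ
  set s := t⁻¹ with hsdef
  set q : ℂ := - (a 2 * s) / (3 * a 3) with hq
  have hq' : 3 * a 3 * q = - (a 2 * s) := by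
    rw [hq]; field_simp
  rw [← hQ t q 0 s a (by linear_combination hs)]
  have e : tc t q 0 s a = slice ![-3 * tc t q 0 s a 1, -27 * tc t q 0 s a 0] := by
    ext i
    fin_cases i
    · simp [slice]
    · simp [slice]
    · simp [slice, tc, h4]
      linear_combination t ^ 2 * s * hq'
    · simp [slice, tc, h4]
      linear_combination (t * s) * ht' + hs
    · simp [slice, tc, h4]
  rw [e, h0]

lemma vanish2 (Q : MvPolynomial (Fin 5) ℂ) (hQ : IsQuarticInvariant Q)
    (h0 : ∀ v, eval (slice v) Q = 0) (a : Fin 5 → ℂ) (h4 : a 4 = 0) :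
    eval a Q = 0 := by
  -- restrict to the line `a + t e₃`
  let R : Polynomial ℂ := aeval (R := ℂ) (fun i : Fin 5 =>
    if i = 3 then Polynomial.X else Polynomial.C (a i)) Q
  have hR : ∀ t : ℂ, R.eval t = eval (Function.update a 3 t) Q := by
    intro t
    have : (Polynomial.evalRingHom t).comp (aeval (R := ℂ) (fun i : Fin 5 =>
        if i = 3 then Polynomial.X else Polynomial.C (a i)) : _ →ₐ[ℂ] _).toRingHom =
        eval (Function.update a 3 t) := by
      apply MvPolynomial.ringHom_ext
      · intro c
        simp
      · intro i
        by_cases hi : i = 3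
        · subst hi; simp
        · simp [hi]
    exact congrArg (fun r => r Q) this
  have hz : R = 0 := by
    apply Polynomial.eq_zero_of_infinite_isRoot
    refine Set.Infinite.mono (s := {(0 : ℂ)}ᶜ) ?_ (Set.finite_singleton _).infinite_compl
    intro t ht
    change R.eval t = 0
    rw [hR]
    apply vanish1 Q hQ h0
    · simp [h4]
    · simpa using ht
  have := hR (a 3)
  rw [hz, Function.update_eq_self] at this
  simpa using this.symm

lemma vanish3 (Q : MvPolynomial (Fin 5) ℂ) (hQ : IsQuarticInvariant Q)
    (h0 : ∀ v, eval (slice v) Q = 0) (a : Fin 5 → ℂ) : eval a Q = 0 := by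
  by_cases h4 : a 4 = 0
  · exact vanish2 Q hQ h0 a h4
  let R : Polynomial ℂ := Polynomial.C (a 4) * Polynomial.X ^ 4 + Polynomial.C (a 3) * Polynomial.X ^ 3
    + Polynomial.C (a 2) * Polynomial.X ^ 2 + Polynomial.C (a 1) * Polynomial.X + Polynomial.C (a 0)
  have hdeg : R.degree ≠ 0 := by
    have : R.degree = 4 := by
      simp only [R]
      compute_degree!
    rw [this]
    norm_num
  obtain ⟨z, hz⟩ := IsAlgClosed.exists_root R hdeg
  have hz' : a 4 * z ^ 4 + a 3 * z ^ 3 + a 2 * z ^ 2 + a 1 * z + a 0 = 0 := by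
    simpa [R, Polynomial.IsRoot] using hz
  rw [← (isQuarticInvariant_iff Q).mp hQ z (-1) 1 0 a (by norm_num)]
  apply vanish2 Q hQ h0
  simp [tc]
  linear_combination hz'

theorem invariants_part : ∃ g₂ g₃ : MvPolynomial (Fin 5) ℂ,
      g₂.IsHomogeneous 2 ∧ g₃.IsHomogeneous 3 ∧
      IsQuarticInvariant g₂ ∧ IsQuarticInvariant g₃ ∧
      Function.Injective (aeval (R := ℂ) ![g₂, g₃]) ∧
      (∀ P : MvPolynomial (Fin 5) ℂ,
        P ∈ Set.range (aeval (R := ℂ) ![g₂, g₃]) ↔ IsQuarticInvariant P) := by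
  refine ⟨invI, invJ, invI_homog, invJ_homog, invI_inv, invJ_inv, aeval_inj, fun P => ⟨?_, ?_⟩⟩
  · rintro ⟨F, rfl⟩
    exact aeval_inv F
  · intro hP
    refine ⟨restr P, ?_⟩
    symm
    rw [← sub_eq_zero]
    apply MvPolynomial.funext
    intro a
    rw [map_zero]
    apply vanish3
    · intro g b
      rw [map_sub, map_sub, hP g b, aeval_inv _ g b]
    · intro v
      rw [map_sub, eval_slice, eval_restr, sub_self]

end Invariants

section Veronese

set_option linter.unusedSectionVars false

open HomogeneousLocalization

variable {σ τ A B : Type} [CommRing A] [SetLike σ A] [AddSubgroupClass σ A]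
  [CommRing B] [SetLike τ B] [AddSubgroupClass τ B]
  (𝒜 : ℕ → σ) [GradedRing 𝒜] (ℬ : ℕ → τ) [GradedRing ℬ]

lemma powers_le_comap' (φ : B →+* A) (f : B) :
    Submonoid.powers f ≤ (Submonoid.powers (φ f)).comap φ := by
  rintro _ ⟨n, rfl⟩
  exact ⟨n, by simp⟩

/-- Transport of a homogeneous fraction along a ring map multiplying degrees by `d`. -/
def verNum (φ : B →+* A) (d : ℕ) (hφ : ∀ n b, b ∈ ℬ n → φ b ∈ 𝒜 (d * n)) (f : B)
    (x : NumDenSameDeg ℬ (Submonoid.powers f)) : NumDenSameDeg 𝒜 (Submonoid.powers (φ f)) :=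
  ⟨d * x.1, ⟨φ x.2, hφ _ _ x.2.2⟩, ⟨φ x.3, hφ _ _ x.3.2⟩, powers_le_comap' φ f x.4⟩

lemma verNum_val (φ : B →+* A) (d : ℕ) (hφ : ∀ n b, b ∈ ℬ n → φ b ∈ 𝒜 (d * n)) (f : B)
    (x : NumDenSameDeg ℬ (Submonoid.powers f)) :
    (HomogeneousLocalization.mk (verNum 𝒜 ℬ φ d hφ f x)).val =
      IsLocalization.map (Localization (Submonoid.powers (φ f))) φ (powers_le_comap' φ f)
        (HomogeneousLocalization.mk x).val := by
  rw [val_mk, val_mk, Localization.mk_eq_mk', Localization.mk_eq_mk', IsLocalization.map_mk']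
  rfl

/-- The underlying function of `verHom`. -/
noncomputable def verFun (φ : B →+* A) (d : ℕ) (hφ : ∀ n b, b ∈ ℬ n → φ b ∈ 𝒜 (d * n)) (f : B) :
    Away ℬ f → Away 𝒜 (φ f) :=
  fun x => HomogeneousLocalization.mk
    (verNum 𝒜 ℬ φ d hφ f (HomogeneousLocalization.mk_surjective x).choose)

lemma verFun_val (φ : B →+* A) (d : ℕ) (hφ : ∀ n b, b ∈ ℬ n → φ b ∈ 𝒜 (d * n)) (f : B)
    (x : Away ℬ f) :
    (verFun 𝒜 ℬ φ d hφ f x).val =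
      IsLocalization.map (Localization (Submonoid.powers (φ f))) φ (powers_le_comap' φ f) x.val := by
  rw [verFun, verNum_val, (HomogeneousLocalization.mk_surjective x).choose_spec]

/-- The map on degree-zero localizations induced by a ring map multiplying degrees by `d`. -/
noncomputable def verHom (φ : B →+* A) (d : ℕ) (hφ : ∀ n b, b ∈ ℬ n → φ b ∈ 𝒜 (d * n)) (f : B) :
    Away ℬ f →+* Away 𝒜 (φ f) where
  toFun := verFun 𝒜 ℬ φ d hφ f
  map_add' x y := val_injective _ (by rw [val_add]; simp only [verFun_val, val_add, map_add])
  map_mul' x y := val_injective _ (by rw [val_mul]; simp only [verFun_val, val_mul, map_mul])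
  map_zero' := val_injective _ (by simp only [verFun_val, val_zero, map_zero])
  map_one' := val_injective _ (by simp only [verFun_val, val_one, map_one])

lemma verHom_val_mk (φ : B →+* A) (d : ℕ) (hφ : ∀ n b, b ∈ ℬ n → φ b ∈ 𝒜 (d * n)) (f : B)
    {m : ℕ} (hf : f ∈ ℬ m) (n : ℕ) (a : B) (ha : a ∈ ℬ (n • m)) :
    (verHom 𝒜 ℬ φ d hφ f (Away.mk ℬ hf n a ha)).val =
      Localization.mk (φ a) (⟨φ f ^ n, ⟨n, rfl⟩⟩ : Submonoid.powers (φ f)) := by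
  change (verFun 𝒜 ℬ φ d hφ f _).val = _
  rw [verFun_val, Away.val_mk, Localization.mk_eq_mk', IsLocalization.map_mk',
    Localization.mk_eq_mk']
  congr 1
  apply Subtype.ext
  simp

lemma verHom_bijective (φ : B →+* A) (d : ℕ) (hφ : ∀ n b, b ∈ ℬ n → φ b ∈ 𝒜 (d * n))
    (hinj : Function.Injective φ) (hsurj : ∀ n a, a ∈ 𝒜 (d * n) → ∃ b ∈ ℬ n, φ b = a) (f : B)
    {m : ℕ} (hf : f ∈ ℬ m) :
    Function.Bijective (verHom 𝒜 ℬ φ d hφ f) := by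
  constructor
  · rw [injective_iff_map_eq_zero]
    intro x hx
    obtain ⟨n, a, ha, rfl⟩ := Away.mk_surjective ℬ hf x
    have h := congrArg val hx
    rw [verHom_val_mk, val_zero, Localization.mk_eq_mk', IsLocalization.mk'_eq_zero_iff] at h
    obtain ⟨⟨_, k, rfl⟩, hk⟩ := h
    apply val_injective
    rw [val_zero, Away.val_mk, Localization.mk_eq_mk', IsLocalization.mk'_eq_zero_iff]
    refine ⟨⟨_, k, rfl⟩, ?_⟩
    apply hinj
    simpa using hk
  · intro y
    obtain ⟨n, a, ha, rfl⟩ := Away.mk_surjective 𝒜 (hφ m f hf) y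
    obtain ⟨b, hb, rfl⟩ := hsurj (n • m) a (by
      have : d * (n • m) = n • (d * m) := by simp only [smul_eq_mul]; ring
      rwa [this])
    refine ⟨Away.mk ℬ hf n b hb, ?_⟩
    apply val_injective
    rw [verHom_val_mk, Away.val_mk]

lemma verHom_awayMap (φ : B →+* A) (d : ℕ) (hφ : ∀ n b, b ∈ ℬ n → φ b ∈ 𝒜 (d * n)) {f g x : B}
    {m k : ℕ} (hf : f ∈ ℬ m) (hg : g ∈ ℬ k) (hx : x = f * g) (hx' : φ x = φ f * φ g) :
    (awayMap 𝒜 (hφ k g hg) hx').comp (verHom 𝒜 ℬ φ d hφ f) =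
      (verHom 𝒜 ℬ φ d hφ x).comp (awayMap ℬ hg hx) := by
  ext1 z
  obtain ⟨n, a, ha, rfl⟩ := Away.mk_surjective ℬ hf z
  have key : verHom 𝒜 ℬ φ d hφ f (Away.mk ℬ hf n a ha) =
      Away.mk 𝒜 (hφ _ _ hf) n (φ a) (by
        have : n • (d * m) = d * (n • m) := by simp only [smul_eq_mul]; ring
        rw [this]; exact hφ _ _ ha) := by
    apply val_injective
    rw [verHom_val_mk, Away.val_mk]
  apply val_injective
  simp only [RingHom.comp_apply]
  rw [key, awayMap_mk, awayMap_mk, verHom_val_mk, Away.val_mk]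
  simp

/-- The cover of `Proj` by basic opens. -/
noncomputable def projCover {ι : Type} (f : ι → A) {m : ι → ℕ}
    (f_deg : ∀ i, f i ∈ 𝒜 (m i)) (hm : ∀ i, 0 < m i)
    (hf : ⨆ i, Proj.basicOpen 𝒜 (f i) = ⊤) :
    (Proj 𝒜).AffineOpenCover where
  I₀ := ι
  X i := .of (Away 𝒜 (f i))
  f i := Proj.awayι 𝒜 (f i) (f_deg i) (hm i)
  idx x := (TopologicalSpace.Opens.mem_iSup.mp (hf.ge (Set.mem_univ x))).choose
  covers x := by
    change x ∈ (Proj.awayι 𝒜 _ _ _).opensRange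
    rw [Proj.opensRange_awayι]
    exact (TopologicalSpace.Opens.mem_iSup.mp (hf.ge (Set.mem_univ x))).choose_spec

lemma proj_glue {ι : Type} (f : ι → A) {m : ι → ℕ}
    (f_deg : ∀ i, f i ∈ 𝒜 (m i)) (hm : ∀ i, 0 < m i)
    (hf : ⨆ i, Proj.basicOpen 𝒜 (f i) = ⊤) {Y : Scheme.{0}}
    (F : ∀ i, Spec (.of (Away 𝒜 (f i))) ⟶ Y)
    (hF : ∀ i j (x : A) (hx : x = f i * f j),
      Spec.map (CommRingCat.ofHom (awayMap 𝒜 (f_deg j) hx)) ≫ F i =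
      Spec.map (CommRingCat.ofHom (awayMap 𝒜 (f_deg i) (hx.trans (mul_comm _ _)))) ≫ F j) :
    ∃ G : Proj 𝒜 ⟶ Y, ∀ i, Proj.awayι 𝒜 (f i) (f_deg i) (hm i) ≫ G = F i := by
  refine ⟨(projCover 𝒜 f f_deg hm hf).openCover.glueMorphisms F ?_, ?_⟩
  · intro i j
    change Limits.pullback.fst (Proj.awayι 𝒜 (f i) (f_deg i) (hm i))
      (Proj.awayι 𝒜 (f j) (f_deg j) (hm j)) ≫ F i = Limits.pullback.snd _ _ ≫ F j
    rw [← cancel_epi (Proj.pullbackAwayιIso 𝒜 (f_deg i) (hm i) (f_deg j) (hm j) rfl).inv,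
      Proj.pullbackAwayιIso_inv_fst_assoc, Proj.pullbackAwayιIso_inv_snd_assoc]
    exact hF i j _ rfl
  · intro i
    exact (projCover 𝒜 f f_deg hm hf).openCover.ι_glueMorphisms F _ i

lemma proj_hom_ext {ι : Type} (f : ι → A) {m : ι → ℕ}
    (f_deg : ∀ i, f i ∈ 𝒜 (m i)) (hm : ∀ i, 0 < m i)
    (hf : ⨆ i, Proj.basicOpen 𝒜 (f i) = ⊤) {Y : Scheme.{0}} (G H : Proj 𝒜 ⟶ Y)
    (h : ∀ i, Proj.awayι 𝒜 (f i) (f_deg i) (hm i) ≫ G =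
      Proj.awayι 𝒜 (f i) (f_deg i) (hm i) ≫ H) : G = H :=
  (projCover 𝒜 f f_deg hm hf).openCover.hom_ext _ _ h

theorem proj_veronese (φ : B →+* A) (d : ℕ) (hd : 0 < d)
    (hφ : ∀ n b, b ∈ ℬ n → φ b ∈ 𝒜 (d * n))
    (hinj : Function.Injective φ) (hsurj : ∀ n a, a ∈ 𝒜 (d * n) → ∃ b ∈ ℬ n, φ b = a)
    {ι : Type} (f : ι → B) {m : ι → ℕ}
    (f_deg : ∀ i, f i ∈ ℬ (m i)) (hm : ∀ i, 0 < m i)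
    (hf : ⨆ i, Proj.basicOpen ℬ (f i) = ⊤)
    (hf' : ⨆ i, Proj.basicOpen 𝒜 (φ (f i)) = ⊤) :
    Nonempty (Proj 𝒜 ≅ Proj ℬ) := by
  have hm' : ∀ i, 0 < d * m i := fun i => Nat.mul_pos hd (hm i)
  have f_deg' : ∀ i, φ (f i) ∈ 𝒜 (d * m i) := fun i => hφ _ _ (f_deg i)
  let e : ∀ (g : B) (n : ℕ) (_ : g ∈ ℬ n), Away ℬ g ≃+* Away 𝒜 (φ g) := fun g n hg =>
    RingEquiv.ofBijective (verHom 𝒜 ℬ φ d hφ g) (verHom_bijective 𝒜 ℬ φ d hφ hinj hsurj g hg)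
  have he : ∀ g n hg, (e g n hg : Away ℬ g →+* Away 𝒜 (φ g)) = verHom 𝒜 ℬ φ d hφ g :=
    fun _ _ _ => rfl
  have nat1 : ∀ i j (x : B) (hx : x = f i * f j) (hx' : φ x = φ (f i) * φ (f j)) (hxd),
      (awayMap 𝒜 (f_deg' j) hx').comp (e (f i) _ (f_deg i) : _ →+* _) =
      (e x (m i + m j) hxd : _ →+* _).comp (awayMap ℬ (f_deg j) hx) := by
    intro i j x hx hx' hxd
    exact verHom_awayMap 𝒜 ℬ φ d hφ (f_deg i) (f_deg j) hx hx'
  have nat2 : ∀ i j (x : B) (hx : x = f i * f j) (hx' : φ x = φ (f i) * φ (f j)) (hxd),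
      (awayMap ℬ (f_deg j) hx).comp ((e (f i) _ (f_deg i)).symm : _ →+* _) =
      ((e x (m i + m j) hxd).symm : _ →+* _).comp (awayMap 𝒜 (f_deg' j) hx') := by
    intro i j x hx hx' hxd
    ext1 z
    obtain ⟨w, rfl⟩ := (e (f i) _ (f_deg i)).surjective z
    have := congrArg (fun r => r w) (nat1 i j x hx hx' hxd)
    simp only [RingHom.comp_apply, RingHom.coe_coe] at this ⊢
    rw [this]
    simp
  obtain ⟨F, hF⟩ := proj_glue 𝒜 (fun i => φ (f i)) f_deg' hm' hf'
    (fun i => Spec.map (CommRingCat.ofHom (e (f i) _ (f_deg i) : _ →+* _)) ≫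
      Proj.awayι ℬ (f i) (f_deg i) (hm i)) (by
    intro i j x hx
    have hx1 : x = φ (f i * f j) := by rw [hx, map_mul]
    subst hx1
    have hd1 : f i * f j ∈ ℬ (m i + m j) := SetLike.mul_mem_graded (f_deg i) (f_deg j)
    have hd2 : f i * f j ∈ ℬ (m j + m i) := by rwa [add_comm]
    rw [← Spec.map_comp_assoc, ← Spec.map_comp_assoc, ← CommRingCat.ofHom_comp,
      ← CommRingCat.ofHom_comp, nat1 i j _ rfl hx hd1,
      nat1 j i _ (mul_comm _ _) (hx.trans (mul_comm _ _)) hd2,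
      CommRingCat.ofHom_comp, CommRingCat.ofHom_comp, Spec.map_comp_assoc, Spec.map_comp_assoc,
      Proj.SpecMap_awayMap_awayι, Proj.SpecMap_awayMap_awayι]
    rfl)
  obtain ⟨G, hG⟩ := proj_glue ℬ f f_deg hm hf
    (fun i => Spec.map (CommRingCat.ofHom ((e (f i) _ (f_deg i)).symm : _ →+* _)) ≫
      Proj.awayι 𝒜 (φ (f i)) (f_deg' i) (hm' i)) (by
    intro i j x hx
    subst hx
    have hx : φ (f i * f j) = φ (f i) * φ (f j) := map_mul _ _ _
    have hd1 : f i * f j ∈ ℬ (m i + m j) := SetLike.mul_mem_graded (f_deg i) (f_deg j)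
    have hd2 : f i * f j ∈ ℬ (m j + m i) := by rwa [add_comm]
    rw [← Spec.map_comp_assoc, ← Spec.map_comp_assoc, ← CommRingCat.ofHom_comp,
      ← CommRingCat.ofHom_comp, nat2 i j _ rfl hx hd1,
      nat2 j i _ (mul_comm _ _) (hx.trans (mul_comm _ _)) hd2,
      CommRingCat.ofHom_comp, CommRingCat.ofHom_comp, Spec.map_comp_assoc, Spec.map_comp_assoc,
      Proj.SpecMap_awayMap_awayι, Proj.SpecMap_awayMap_awayι]
    rfl)
  refine ⟨⟨F, G, ?_, ?_⟩⟩
  · apply proj_hom_ext 𝒜 (fun i => φ (f i)) f_deg' hm' hf'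
    intro i
    rw [reassoc_of% (hF i), hG i, ← Spec.map_comp_assoc, ← CommRingCat.ofHom_comp]
    simp
  · apply proj_hom_ext ℬ f f_deg hm hf
    intro i
    rw [reassoc_of% (hG i), hF i, ← Spec.map_comp_assoc, ← CommRingCat.ofHom_comp]
    simp

end Veronese

section ProjP1

lemma iSup_basicOpen_X (w : Fin 2 → ℕ) :
    ⨆ i, Proj.basicOpen (weightedHomogeneousSubmodule ℂ w) (X i) = ⊤ := by
  apply Proj.iSup_basicOpen_eq_top'
  · intro i
    exact ⟨w i, isWeightedHomogeneous_X ℂ w i⟩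
  · rw [eq_top_iff]
    rintro p -
    induction p using MvPolynomial.induction_on with
    | C c =>
      exact Subalgebra.algebraMap_mem _
        (⟨C c, isWeightedHomogeneous_C w c⟩ : weightedHomogeneousSubmodule ℂ w 0)
    | add p q hp hq => exact add_mem hp hq
    | mul_X p i hp => exact mul_mem hp (Algebra.subset_adjoin ⟨i, rfl⟩)

/-- The map `ℂ[s,t] → ℂ[u,v]`, `s ↦ u³`, `t ↦ v²`. -/
noncomputable def phi23 : MvPolynomial (Fin 2) ℂ →+* MvPolynomial (Fin 2) ℂ :=
  (aeval (R := ℂ) (![X 0 ^ 3, X 1 ^ 2] : Fin 2 → MvPolynomial (Fin 2) ℂ)).toRingHom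

/-- Exponents under `phi23`. -/
noncomputable def exp23 (s : Fin 2 →₀ ℕ) : Fin 2 →₀ ℕ :=
  Finsupp.single 0 (3 * s 0) + Finsupp.single 1 (2 * s 1)

lemma exp23_zero (s : Fin 2 →₀ ℕ) : exp23 s 0 = 3 * s 0 := by simp [exp23]

lemma exp23_one (s : Fin 2 →₀ ℕ) : exp23 s 1 = 2 * s 1 := by simp [exp23]

lemma phi23_monomial (s : Fin 2 →₀ ℕ) (c : ℂ) :
    phi23 (monomial s c) = monomial (exp23 s) c := by
  change aeval _ (monomial s c) = _
  rw [aeval_monomial, Finsupp.prod_fintype _ _ (by simp)]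
  simp only [Fin.prod_univ_two, Matrix.cons_val_zero, Matrix.cons_val_one, exp23]
  rw [← pow_mul, ← pow_mul, X_pow_eq_monomial, X_pow_eq_monomial, monomial_mul, algebraMap_eq,
    C_mul_monomial]
  simp

lemma exp23_injective : Function.Injective exp23 := by
  intro s t h
  have h0 := congrArg (fun r => r 0) h
  have h1 := congrArg (fun r => r 1) h
  simp only [exp23_zero, exp23_one] at h0 h1
  ext i
  fin_cases i
  · change s 0 = t 0; omega
  · change s 1 = t 1; omega

lemma coeff_phi23 (p : MvPolynomial (Fin 2) ℂ) (s : Fin 2 →₀ ℕ) :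
    coeff (exp23 s) (phi23 p) = coeff s p := by
  classical
  induction p using MvPolynomial.monomial_add_induction_on with
  | C c =>
    change coeff _ (phi23 (monomial 0 c)) = coeff _ (monomial 0 c)
    rw [phi23_monomial, coeff_monomial, coeff_monomial]
    simp [exp23_injective.eq_iff]
  | monomial_add t c p _ _ ih =>
    rw [map_add, coeff_add, coeff_add, ih, phi23_monomial, coeff_monomial, coeff_monomial]
    simp [exp23_injective.eq_iff]

lemma weight_two (w : Fin 2 → ℕ) (s : Fin 2 →₀ ℕ) :
    Finsupp.weight w s = s 0 * w 0 + s 1 * w 1 := by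
  rw [Finsupp.weight_apply, Finsupp.sum_fintype _ _ (by simp)]
  simp

theorem proj_part :
    Nonempty
      ((AlgebraicGeometry.Proj (weightedHomogeneousSubmodule ℂ (![2, 3] : Fin 2 → ℕ))) ≅
        (AlgebraicGeometry.Proj (weightedHomogeneousSubmodule ℂ (![1, 1] : Fin 2 → ℕ)))) := by
  refine proj_veronese _ _ phi23 6 (by norm_num) ?_ ?_ ?_ (f := X) (m := fun _ => 1) ?_ ?_ ?_ ?_
  · intro n b hb
    rw [b.as_sum, map_sum]
    refine Submodule.sum_mem _ fun s hs => ?_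
    rw [phi23_monomial]
    apply isWeightedHomogeneous_monomial
    have h := hb (mem_support_iff.mp hs)
    rw [weight_two] at h ⊢
    simp only [exp23_zero, exp23_one, Matrix.cons_val_zero, Matrix.cons_val_one] at h ⊢
    omega
  · intro p q h
    ext s
    rw [← coeff_phi23, h, coeff_phi23]
  · intro n a ha
    refine ⟨∑ s ∈ a.support,
      monomial (Finsupp.single 0 (s 0 / 3) + Finsupp.single 1 (s 1 / 2)) (coeff s a), ?_, ?_⟩
    · refine Submodule.sum_mem _ fun s hs => ?_
      apply isWeightedHomogeneous_monomial
      have h := ha (mem_support_iff.mp hs)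
      rw [weight_two] at h ⊢
      simp at h ⊢
      omega
    · conv_rhs => rw [a.as_sum]
      rw [map_sum]
      refine Finset.sum_congr rfl fun s hs => ?_
      rw [phi23_monomial]
      have h := ha (mem_support_iff.mp hs)
      rw [weight_two] at h
      simp at h
      refine congrArg (fun r => monomial r (coeff s a)) ?_
      ext i
      fin_cases i
      · change exp23 _ 0 = s 0
        rw [exp23_zero]
        simp
        omega
      · change exp23 _ 1 = s 1
        rw [exp23_one]
        simp
        omega
  · intro i
    convert isWeightedHomogeneous_X ℂ (![1, 1] : Fin 2 → ℕ) i using 1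
    fin_cases i <;> rfl
  · intro i
    norm_num
  · exact iSup_basicOpen_X _
  · rw [← iSup_basicOpen_X (![2, 3] : Fin 2 → ℕ)]
    congr 1
    ext1 i
    fin_cases i
    · have : phi23 (X 0) = X 0 ^ 3 := by simp [phi23]
      change Proj.basicOpen _ (phi23 (X 0)) = _
      rw [this, Proj.basicOpen_pow _ _ _ (by norm_num)]
      rfl
    · have : phi23 (X 1) = X 1 ^ 2 := by simp [phi23]
      change Proj.basicOpen _ (phi23 (X 1)) = _
      rw [this, Proj.basicOpen_pow _ _ _ (by norm_num)]
      rfl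

end ProjP1

/-- the ring of invariants of `SL(2,ℂ)` acting on binary quartic forms
is a polynomial ring on two generators `g₂`, `g₃`, homogeneous of degrees `2` and `3`
in the coefficients: the algebra map from the polynomial ring in two variables sending
the variables to `g₂`, `g₃` is injective with image exactly the invariants.
Consequently `Proj` of this invariant ring — `Proj` of a graded polynomial ring on
generators of degrees `2` and `3` — is isomorphic to `ℙ¹`. -/
theorem stmt5_binary_quartic_invariants :
    (∃ g₂ g₃ : MvPolynomial (Fin 5) ℂ,
      g₂.IsHomogeneous 2 ∧ g₃.IsHomogeneous 3 ∧
      IsQuarticInvariant g₂ ∧ IsQuarticInvariant g₃ ∧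
      Function.Injective (aeval (R := ℂ) ![g₂, g₃]) ∧
      (∀ P : MvPolynomial (Fin 5) ℂ,
        P ∈ Set.range (aeval (R := ℂ) ![g₂, g₃]) ↔ IsQuarticInvariant P)) ∧
    Nonempty
      ((AlgebraicGeometry.Proj (weightedHomogeneousSubmodule ℂ (![2, 3] : Fin 2 → ℕ))) ≅
        (AlgebraicGeometry.Proj (weightedHomogeneousSubmodule ℂ (![1, 1] : Fin 2 → ℕ)))) := by
  exact ⟨invariants_part, proj_part⟩
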